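/- Let p be a prime with p ≡ 1 (mod 3), t a positive integer divisible by 3, and r = p^t. Then there exists a multiplicative character ρ of GF(r) of order 3 such that the Gauss sums τ(ρ) = Σ_{x ∈ GF(r)^*} ρ(x)ψ(x) and τ(ρ²) satisfy τ(ρ) = (−1)^{t+1} p^{t/3} π^{t/3} and τ(ρ²) = (−1)^{t+1} p^{t/3} π̄^{t/3}. -/

import Mathlib

open scoped Classical

/-- The ring `ℤ[ω]` of Eisenstein integers, with `ω² = -1 - ω`. -/
abbrev EisensteinInt : Type := QuadraticAlgebra ℤ (-1) (-1)

namespace EisensteinInt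

open QuadraticAlgebra

theorem norm_eq (z : EisensteinInt) : z.norm = z.re ^ 2 - z.re * z.im + z.im ^ 2 := by
  rw [norm_def]; ring

theorem mul_star_eq_norm (z : EisensteinInt) : z * star z = (z.norm : EisensteinInt) :=
  (algebraMap_norm_eq_mul_star z).symm

theorem eq_zero_of_norm_eq_zero {z : EisensteinInt} (h : z.norm = 0) : z = 0 := by
  rw [norm_eq] at h
  have hi : z.im = 0 := by nlinarith [sq_nonneg (2 * z.re - z.im), sq_nonneg z.im]
  have hr : z.re = 0 := by
    rw [hi] at h
    simpa using h
  ext <;> simpa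

instance : NoZeroDivisors EisensteinInt where
  eq_zero_or_eq_zero_of_mul_eq_zero {a b} h := by
    have : a.norm * b.norm = 0 := by rw [← map_mul, h, QuadraticAlgebra.norm_zero]
    exact (mul_eq_zero.mp this).imp eq_zero_of_norm_eq_zero eq_zero_of_norm_eq_zero

instance : IsDomain EisensteinInt := NoZeroDivisors.to_isDomain _

theorem intCast_dvd_iff {n : ℤ} {z : EisensteinInt} :
    (n : EisensteinInt) ∣ z ↔ n ∣ z.re ∧ n ∣ z.im :=
  algebraMap_dvd_iff

theorem dvd_or_star_dvd_of_dvd_norm {p : ℤ} (hp : Prime p) {q z : EisensteinInt}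
    (hq : q.norm = p) (hz : p ∣ z.norm) : q ∣ z ∨ star q ∣ z := by
  have key (q : EisensteinInt) (hq : q.norm = p) (h : p ∣ (star q * z).im) : q ∣ z := by
    have hre : p ∣ (star q * z).re := by
      have hn : p ∣ (star q * z).norm := by
        rw [map_mul]
        exact hz.mul_left _
      rw [norm_eq] at hn
      refine hp.dvd_of_dvd_pow (n := 2) ?_
      have e : (star q * z).re ^ 2 = ((star q * z).re ^ 2 - (star q * z).re * (star q * z).im
          + (star q * z).im ^ 2) + (star q * z).im * ((star q * z).re - (star q * z).im) := by ring
      rw [e]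
      exact dvd_add hn (h.mul_right _)
    obtain ⟨w, hw⟩ := intCast_dvd_iff.mpr ⟨hre, h⟩
    have hp0 : (p : EisensteinInt) ≠ 0 := by exact_mod_cast hp.ne_zero
    refine ⟨w, mul_left_cancel₀ hp0 ?_⟩
    calc (p : EisensteinInt) * z = q * (star q * z) := by rw [← hq, ← mul_star_eq_norm]; ring
      _ = p * (q * w) := by rw [hw]; ring
  have h : p ∣ (star q * z).im * (q * z).im := by
    have e : (star q * z).im * (q * z).im = q.re ^ 2 * z.im ^ 2 - q.re * q.im * z.im ^ 2
        - q.im ^ 2 * (z.re ^ 2 - z.re * z.im) := by simp; ring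
    have e' : (star q * z).im * (q * z).im = q.norm * z.im ^ 2 - q.im ^ 2 * z.norm := by
      rw [e, norm_eq, norm_eq]; ring
    rw [e', hq]
    exact dvd_sub (dvd_mul_right _ _) (hz.mul_left _)
  rcases hp.dvd_or_dvd h with h | h
  · exact .inl (key q hq h)
  · exact .inr (key (star q) (by rw [QuadraticAlgebra.norm_star, hq]) (by rwa [star_star]))

theorem exists_eq_unit_mul_pow_mul_star_pow {p : ℤ} (hp : Prime p) {q : EisensteinInt}
    (hq : q.norm = p) (n : ℕ) {z : EisensteinInt} (hz : z.norm = p ^ n) :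
    ∃ (u : EisensteinInt) (i j : ℕ), u.norm = 1 ∧ i + j = n ∧ z = u * q ^ i * star q ^ j := by
  induction n generalizing z with
  | zero => exact ⟨z, 0, 0, by simpa using hz, rfl, by simp⟩
  | succ n ih =>
    rcases dvd_or_star_dvd_of_dvd_norm hp hq (z := z) (hz ▸ dvd_pow_self p n.succ_ne_zero) with
      ⟨w, rfl⟩ | ⟨w, rfl⟩
    · rw [map_mul, hq, pow_succ'] at hz
      obtain ⟨u, i, j, hu, hij, rfl⟩ := ih (mul_left_cancel₀ hp.ne_zero hz)
      exact ⟨u, i + 1, j, hu, by lia, by ring⟩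
    · rw [map_mul, QuadraticAlgebra.norm_star, hq, pow_succ'] at hz
      obtain ⟨u, i, j, hu, hij, rfl⟩ := ih (mul_left_cancel₀ hp.ne_zero hz)
      exact ⟨u, i, j + 1, hu, by lia, by ring⟩

theorem exists_eq_unit_mul_pow {p : ℤ} (hp : Prime p) {q : EisensteinInt}
    (hq : q.norm = p) {n : ℕ} {z : EisensteinInt} (hz : z.norm = p ^ n)
    (hpz : ¬ (p : EisensteinInt) ∣ z) :
    ∃ u : EisensteinInt, u.norm = 1 ∧ (z = u * q ^ n ∨ z = u * star q ^ n) := by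
  obtain ⟨u, i, j, hu, hij, rfl⟩ := exists_eq_unit_mul_pow_mul_star_pow hp hq n hz
  refine ⟨u, hu, ?_⟩
  rcases i with - | i
  · right; simp [← hij]
  rcases j with - | j
  · left; simp [← hij]
  · refine absurd ?_ hpz
    rw [← hq, ← mul_star_eq_norm]
    exact ⟨u * q ^ i * star q ^ j, by ring⟩

theorem three_dvd_iff {z : EisensteinInt} : 3 ∣ z ↔ 3 ∣ z.re ∧ 3 ∣ z.im := by
  simpa using intCast_dvd_iff (n := 3) (z := z)

theorem eq_one_of_norm_eq_one {u : EisensteinInt} (hu : u.norm = 1) (h : 3 ∣ u - 1) : u = 1 := by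
  obtain ⟨h1, h2⟩ := three_dvd_iff.mp h
  simp only [re_sub, re_one, im_sub, im_one, sub_zero] at h1 h2
  rw [norm_eq] at hu
  have hi : u.im = 0 := by
    obtain ⟨k, hk⟩ := h2
    have : k = 0 := by
      rw [hk] at hu
      by_contra hk0
      have : 1 ≤ k ^ 2 := by have := sq_pos_of_ne_zero hk0; lia
      nlinarith [sq_nonneg (2 * u.re - 3 * k)]
    rw [hk, this, mul_zero]
  rw [hi] at hu
  have hr : u.re = 1 := by
    rcases eq_or_eq_neg_of_sq_eq_sq u.re 1 (by simpa using hu) with h | h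
    · exact h
    · rw [h] at h1; norm_num at h1
  ext <;> simpa

theorem omega_mul_omega : (omega : EisensteinInt) * omega = -1 - omega := by ext <;> simp

/-- An Eisenstein integer congruent to `-1` modulo `3` is determined by its cube. -/
theorem eq_of_pow_three_eq {T B : EisensteinInt} (hT : 3 ∣ T + 1) (hB : 3 ∣ B + 1)
    (h : T ^ 3 = B ^ 3) : T = B := by
  have aux (v : EisensteinInt) (hv : ¬ (3 : EisensteinInt) ∣ v - 1) : T - v * B ≠ 0 := by
    intro h0
    refine hv ?_
    have : v - 1 = v * (B + 1) - (T + 1) + (T - v * B) := by ring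
    rw [this, h0, add_zero]
    exact dvd_sub (hB.mul_left _) hT
  have h1 := aux omega (by rw [three_dvd_iff]; simp)
  have h2 := aux (-1 - omega) (by rw [three_dvd_iff]; simp)
  have : (T - B) * ((T - omega * B) * (T - (-1 - omega) * B)) = 0 := by
    linear_combination h - (T - B) * B ^ 2 * omega_mul_omega
  exact sub_eq_zero.mp ((mul_eq_zero.mp this).resolve_right (mul_ne_zero h1 h2))

theorem eq_of_pow_three_eq_mul {p s : ℕ} (hp3 : p % 3 = 1) {q T z u : EisensteinInt}
    (hq : 3 ∣ q + 1) (hT : 3 ∣ T + 1) (hTz : T ^ 3 = (p : EisensteinInt) ^ (3 * s) * z)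
    (hu : u.norm = 1) (hz : z = u * q ^ (3 * s)) :
    T = (-1) ^ (3 * s + 1) * (p : EisensteinInt) ^ s * q ^ s := by
  set I : Ideal EisensteinInt := Ideal.span {3}
  let m := Ideal.Quotient.mk I
  have mem (x : EisensteinInt) : 3 ∣ x ↔ m x = 0 := by
    rw [Ideal.Quotient.eq_zero_iff_mem, Ideal.mem_span_singleton]
  have mq : m q = -1 := by rw [mem] at hq; rwa [map_add, map_one, add_eq_zero_iff_eq_neg] at hq
  have mT : m T = -1 := by rw [mem] at hT; rwa [map_add, map_one, add_eq_zero_iff_eq_neg] at hT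
  have mp : m p = 1 := by
    have : (3 : EisensteinInt) ∣ (p : EisensteinInt) - 1 := by
      rw [three_dvd_iff]; simp; lia
    rw [mem, map_sub, map_one, sub_eq_zero] at this
    exact this
  have mu : (-1) ^ (3 * s) * m u = -1 := by
    have := congrArg m hTz
    simp only [hz, map_mul, map_pow, mT, mp, mq, one_pow, one_mul] at this
    rw [mul_comm, ← this]; ring
  have hs : ((-1 : EisensteinInt ⧸ I) ^ (3 * s)) * (-1) ^ (3 * s) = 1 := by
    rw [← mul_pow]; simp
  have hs' : ((-1 : EisensteinInt) ^ (3 * s)) * (-1) ^ (3 * s) = 1 := by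
    rw [← mul_pow]; simp
  have hu1 : (-1) ^ (3 * s + 1) * u = 1 := by
    apply eq_one_of_norm_eq_one
    · rw [map_mul, hu, map_pow, QuadraticAlgebra.norm_neg, QuadraticAlgebra.norm_one]; simp
    · rw [mem, map_sub, map_mul, map_pow, map_neg, map_one, pow_succ]
      linear_combination -mu
  refine eq_of_pow_three_eq hT ?_ ?_
  · rw [mem]
    simp only [map_add, map_mul, map_pow, map_neg, map_one, mp, mq]
    have : (-1 : EisensteinInt ⧸ I) ^ s * (-1) ^ s = 1 := by rw [← mul_pow]; simp
    have e : (-1 : EisensteinInt ⧸ I) ^ (3 * s + 1) = - (-1) ^ s * ((-1) ^ s * (-1) ^ s) := by ring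
    rw [e, this]
    linear_combination -this
  · rw [hTz, hz]
    have hu2 : u = (-1) ^ (3 * s + 1) := by
      rw [pow_succ] at hu1 ⊢
      linear_combination -u * hs' - (-1) ^ (3 * s) * hu1
    have e : ((-1 : EisensteinInt) ^ (3 * s + 1)) ^ 3 = (-1) ^ (3 * s + 1) := by
      rw [← pow_mul, mul_comm, pow_mul]; norm_num
    rw [mul_pow, mul_pow, e, hu2]; ring

theorem eq_of_norm_eq_of_pow_three_eq_mul {p s : ℕ} (hp : p.Prime) (hp3 : p % 3 = 1)
    {q T z : EisensteinInt} (hqp : q.norm = p) (hq : 3 ∣ q + 1) (hT : 3 ∣ T + 1)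
    (hTz : T ^ 3 = (p : EisensteinInt) ^ (3 * s) * z) (hz : z.norm = p ^ (3 * s))
    (hpz : ¬ (p : EisensteinInt) ∣ z) :
    T = (-1) ^ (3 * s + 1) * (p : EisensteinInt) ^ s * q ^ s ∨
      T = (-1) ^ (3 * s + 1) * (p : EisensteinInt) ^ s * star q ^ s := by
  obtain ⟨u, hu, h⟩ := exists_eq_unit_mul_pow (Nat.prime_iff_prime_int.mp hp) hqp hz
    (by simpa using hpz)
  refine h.imp (eq_of_pow_three_eq_mul hp3 hq hT hTz hu)
    (eq_of_pow_three_eq_mul hp3 ?_ hT hTz hu)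
  rw [three_dvd_iff] at hq ⊢
  simp at hq ⊢
  lia

end EisensteinInt

theorem Nat.Prime.not_dvd_choose_two_mul_self {p : ℕ} (hp : p.Prime) (hp3 : p % 3 = 1) (t : ℕ)
    {a : ℕ} (ha : 3 * a + 1 = p ^ t) : ¬ p ∣ (2 * a).choose a := by
  have : Fact p.Prime := ⟨hp⟩
  induction t generalizing a with
  | zero =>
    have : a = 0 := by simpa using ha
    simpa [this] using hp.ne_one
  | succ t ih =>
    obtain ⟨b, hb⟩ : ∃ b, p = 3 * b + 1 := ⟨p / 3, by lia⟩
    obtain ⟨c, hc⟩ : ∃ c, 3 * c + 1 = p ^ t := by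
      have h : p ^ t % 3 = 1 := by rw [Nat.pow_mod, hp3, one_pow]; rfl
      exact ⟨p ^ t / 3, by lia⟩
    have hac : a = b + p * c := by
      rw [pow_succ, ← hc] at ha
      nlinarith
    have hmod : a % p = b := by
      rw [hac, Nat.add_mul_mod_self_left, Nat.mod_eq_of_lt (by lia)]
    have hdiv : a / p = c := by
      rw [hac, Nat.add_mul_div_left _ _ hp.pos, Nat.div_eq_of_lt (by lia), zero_add]
    have h2 : 2 * a = 2 * b + p * (2 * c) := by rw [hac]; ring
    have hmod2 : 2 * a % p = 2 * b := by
      rw [h2, Nat.add_mul_mod_self_left, Nat.mod_eq_of_lt (by lia)]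
    have hdiv2 : 2 * a / p = 2 * c := by
      rw [h2, Nat.add_mul_div_left _ _ hp.pos, Nat.div_eq_of_lt (by lia), zero_add]
    have lucas := Choose.choose_modEq_choose_mod_mul_choose_div_nat (n := 2 * a) (k := a) (p := p)
    rw [hmod, hdiv, hmod2, hdiv2] at lucas
    rw [lucas.dvd_iff dvd_rfl, hp.dvd_mul, not_or]
    refine ⟨fun h ↦ ?_, ih hc⟩
    have := hp.dvd_factorial.mp (h.trans ⟨_, (Nat.choose_mul_factorial_mul_factorial
      (show b ≤ 2 * b by lia)).symm.trans (mul_assoc _ _ _)⟩)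
    lia

section

variable {F : Type*} [Field F] [Fintype F]

theorem FiniteField.sum_pow_eq_ite {i : ℕ} (hi : i ≠ 0) :
    ∑ x : F, x ^ i = if Fintype.card F - 1 ∣ i then -1 else 0 := by
  rw [← FiniteField.sum_pow_units, ← Finset.sum_subset
    (Finset.subset_univ (Finset.univ.filter (fun x : F ↦ x ≠ 0)))
    (fun x _ hx ↦ by simp at hx; simp [hx, hi])]
  symm
  refine Finset.sum_bij (fun u _ ↦ (u : F)) (by simp) (fun _ _ _ _ h ↦ Units.ext h) ?_ (by simp)
  intro x hx
  simp at hx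
  exact ⟨Units.mk0 x hx, by simp, rfl⟩

theorem FiniteField.sum_pow_mul_one_sub_pow {a : ℕ} (ha : a ≠ 0)
    (hcard : 3 * a + 1 = Fintype.card F) :
    ∑ x : F, x ^ (2 * a) * (1 - x) ^ (2 * a) = -((-1) ^ a * ((2 * a).choose a : F)) := by
  have hsum (x : F) : x ^ (2 * a) * (1 - x) ^ (2 * a) = ∑ j ∈ Finset.range (2 * a + 1),
      (-1) ^ j * ((2 * a).choose j : F) * x ^ (2 * a + j) := by
    rw [sub_eq_neg_add, add_pow, Finset.mul_sum]
    refine Finset.sum_congr rfl fun j _ ↦ ?_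
    rw [neg_pow, pow_add]
    ring
  simp_rw [hsum]
  rw [Finset.sum_comm]
  simp_rw [← Finset.mul_sum]
  rw [Finset.sum_eq_single a]
  · rw [FiniteField.sum_pow_eq_ite (by lia), if_pos ⟨1, by lia⟩]
    ring
  · intro j hj hja
    rw [FiniteField.sum_pow_eq_ite (by lia), if_neg, mul_zero]
    rintro ⟨k, hk⟩
    rw [← hcard, Nat.add_sub_cancel] at hk
    have hj' := Finset.mem_range.mp hj
    obtain hk1 | hk1 : k ≤ 1 ∨ 2 ≤ k := by lia
    · interval_cases k <;> lia
    · have := Nat.mul_le_mul_left (3 * a) hk1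
      lia
  · intro h
    exact absurd (Finset.mem_range.mpr (by lia)) h

end

/-- A sum over a finite type that is invariant under a map of order dividing `3` is congruent modulo
`3` to the sum over the fixed points. -/
theorem three_dvd_sum_sub_sum_fixed {α R : Type*} [Fintype α] [CommRing R] (σ : α → α)
    (hσ : ∀ x, σ (σ (σ x)) = x) (f : α → R) (hf : ∀ x, f (σ x) = f x) :
    3 ∣ ∑ x, f x - ∑ x with σ x = x, f x := by
  have e1 := Finset.sum_comp (s := Finset.univ) (id : R → R) f
  have e2 : ∑ x with σ x = x, f x = ∑ b ∈ Finset.univ.image f,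
      ((Finset.univ.filter (fun x ↦ σ x = x)).filter (fun x ↦ f x = b)).card • b := by
    rw [← Finset.sum_fiberwise_of_maps_to (t := Finset.univ.image f) (g := f) (by simp)]
    refine Finset.sum_congr rfl fun b _ ↦ ?_
    rw [Finset.sum_congr rfl (g := fun _ ↦ b) (fun x hx ↦ (Finset.mem_filter.mp hx).2),
      Finset.sum_const]
  simp only [id] at e1
  rw [e1, e2, ← Finset.sum_sub_distrib]
  refine Finset.dvd_sum fun b _ ↦ ?_
  let τ : Function.End {x // f x = b} := fun x ↦ ⟨σ x, (hf x).trans x.2⟩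
  have hτ : τ ^ 3 ^ 1 = 1 := by
    funext x
    exact Subtype.ext (hσ x)
  have h := Equiv.Perm.card_fixedPoints_modEq hτ
  have c1 : Fintype.card {x // f x = b} = (Finset.univ.filter (fun x ↦ f x = b)).card :=
    Fintype.card_subtype _
  have c2 : Fintype.card (Function.fixedPoints τ) =
      ((Finset.univ.filter (fun x ↦ σ x = x)).filter (fun x ↦ f x = b)).card := by
    rw [← Fintype.card_coe]
    refine Fintype.card_congr
      { toFun := fun x ↦ ⟨x.1.1, ?_⟩, invFun := fun x ↦ ⟨⟨x.1, ?_⟩, ?_⟩,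
        left_inv := fun _ ↦ rfl, right_inv := fun _ ↦ rfl }
    · have := congrArg Subtype.val x.2
      simp only [Finset.mem_filter, Finset.mem_univ, true_and]
      exact ⟨this, x.1.2⟩
    · have := x.2
      simp only [Finset.mem_filter] at this
      exact this.2
    · have := x.2
      simp only [Finset.mem_filter] at this
      exact Subtype.ext this.1.2
  rw [c1, c2] at h
  obtain ⟨k, hk⟩ := h.symm.dvd
  refine ⟨k * b, ?_⟩
  rw [nsmul_eq_mul, nsmul_eq_mul, ← sub_mul, ← mul_assoc]
  congr 1
  exact_mod_cast congrArg (Int.cast : ℤ → R) hk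

section

variable {p : ℕ} [Fact p.Prime] {F : Type*} [Field F] [Fintype F] [Algebra (ZMod p) F]

theorem gaussSum_trace_eq_sub {R : Type*} [CommRing R] [IsDomain R] (χ : MulChar F R)
    (hχ : ∀ c : ZMod p, c ≠ 0 → χ (algebraMap (ZMod p) F c) = 1)
    (ψ : AddChar F R) (ζ : AddChar (ZMod p) R) (hζ : ζ ≠ 1)
    (hψ : ∀ x, ψ x = ζ (Algebra.trace (ZMod p) F x)) :
    gaussSum χ ψ = ∑ x with Algebra.trace (ZMod p) F x = 0, χ x -
      ∑ x with Algebra.trace (ZMod p) F x = 1, χ x := by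
  have hT (c : ZMod p) (hc : c ≠ 0) : ∑ x with Algebra.trace (ZMod p) F x = c, χ x =
      ∑ x with Algebra.trace (ZMod p) F x = 1, χ x := by
    have hc' : algebraMap (ZMod p) F c ≠ 0 := by simpa using hc
    symm
    refine Finset.sum_bij (fun x _ ↦ c • x) ?_ ?_ ?_ ?_
    · intro x hx
      simp only [Finset.mem_filter, Finset.mem_univ, true_and] at hx ⊢
      rw [map_smul, hx, smul_eq_mul, mul_one]
    · intro x _ y _ h
      exact smul_right_injective F hc h
    · intro y hy
      refine ⟨c⁻¹ • y, ?_, by rw [smul_inv_smul₀ hc]⟩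
      simp only [Finset.mem_filter, Finset.mem_univ, true_and] at hy ⊢
      rw [map_smul, hy, smul_eq_mul, inv_mul_cancel₀ hc]
    · intro x _
      rw [Algebra.smul_def, map_mul, hχ c hc, one_mul]
  have hsum : gaussSum χ ψ = ∑ c : ZMod p, ζ c * ∑ x with Algebra.trace (ZMod p) F x = c, χ x := by
    rw [gaussSum, ← Finset.sum_fiberwise Finset.univ (Algebra.trace (ZMod p) F)]
    refine Finset.sum_congr rfl fun c _ ↦ ?_
    rw [Finset.mul_sum]
    refine Finset.sum_congr rfl fun x hx ↦ ?_
    rw [hψ, (Finset.mem_filter.mp hx).2, mul_comm]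
  have hζ0 : ∑ c : ZMod p, ζ c = 0 := AddChar.sum_eq_zero_of_ne_one hζ
  rw [← Finset.add_sum_erase _ _ (Finset.mem_univ 0), AddChar.map_zero_eq_one] at hζ0
  rw [hsum, ← Finset.add_sum_erase _ _ (Finset.mem_univ 0), AddChar.map_zero_eq_one, one_mul,
    Finset.sum_congr (s₁ := Finset.univ.erase (0 : ZMod p)) rfl
      (fun c hc ↦ by rw [hT c (Finset.ne_of_mem_erase hc)]), ← Finset.sum_mul]
  linear_combination (∑ x with Algebra.trace (ZMod p) F x = 1, χ x) * hζ0

theorem three_dvd_sum_sub_sum_add_one {R : Type*} [CommRing R] (hp3 : p ≠ 3)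
    (σ : F ≃ₐ[ZMod p] F) (hσ : ∀ x, σ (σ (σ x)) = x) (χ : MulChar F R)
    (hχσ : ∀ x, χ (σ x) = χ x) (hχ : ∀ x, x ≠ 0 → σ x = x → χ x = 1) :
    3 ∣ ∑ x with Algebra.trace (ZMod p) F x = 0, χ x -
      ∑ x with Algebra.trace (ZMod p) F x = 1, χ x + 1 := by
  let tr := Algebra.trace (ZMod p) F
  have htrσ (x : F) : tr (σ x) = tr x := Algebra.trace_eq_of_algEquiv σ x
  have hmod (c : ZMod p) : 3 ∣ ∑ x with tr x = c, χ x -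
      ∑ x with σ x = x, if tr x = c then χ x else 0 := by
    rw [Finset.sum_filter]
    exact three_dvd_sum_sub_sum_fixed σ hσ (fun x ↦ if tr x = c then χ x else 0)
      (fun x ↦ by simp only [htrσ, hχσ])
  obtain ⟨y, hyσ, hy⟩ : ∃ y, σ y = y ∧ tr y = 1 := by
    have h3 : (3 : ZMod p) ≠ 0 := by
      intro h
      have : p ∣ 3 := (ZMod.natCast_eq_zero_iff 3 p).mp (by exact_mod_cast h)
      exact hp3 ((Nat.prime_dvd_prime_iff_eq Fact.out Nat.prime_three).mp this)
    obtain ⟨w, hw⟩ := Algebra.trace_surjective (ZMod p) F (3⁻¹)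
    refine ⟨w + σ w + σ (σ w), ?_, ?_⟩
    · rw [map_add, map_add, hσ]; ring
    · rw [map_add, map_add, htrσ, htrσ, htrσ, hw]
      field_simp
      norm_num
  have hcard : ∑ x with σ x = x, (if tr x = 0 then (1 : R) else 0) =
      ∑ x with σ x = x, if tr x = 1 then 1 else 0 := by
    refine Finset.sum_bij (fun x _ ↦ x + y) ?_ ?_ ?_ ?_
    · intro x hx
      simp only [Finset.mem_filter, Finset.mem_univ, true_and] at hx ⊢
      rw [map_add, hx, hyσ]
    · intro a _ b _ h
      exact add_right_cancel h
    · intro x hx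
      simp only [Finset.mem_filter, Finset.mem_univ, true_and] at hx
      exact ⟨x - y, by simp [hx, hyσ], by ring⟩
    · intro x _
      simp [map_add, hy]
  have h0 : ∑ x with σ x = x, (if tr x = 0 then χ x else 0) =
      ∑ x with σ x = x, (if tr x = 0 then (1 : R) else 0) - 1 := by
    have hmem : (0 : F) ∈ Finset.univ.filter (fun x ↦ σ x = x) := by simp
    rw [← Finset.add_sum_erase _ _ hmem, ← Finset.add_sum_erase _ _ hmem]
    simp only [map_zero, if_true, MulChar.map_zero, zero_add, add_sub_cancel_left]
    refine Finset.sum_congr rfl fun x hx ↦ ?_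
    have hx' := Finset.mem_erase.mp hx
    rw [hχ x hx'.1 (Finset.mem_filter.mp hx'.2).2]
  have h1 : ∑ x with σ x = x, (if tr x = 1 then χ x else 0) =
      ∑ x with σ x = x, (if tr x = 1 then (1 : R) else 0) := by
    refine Finset.sum_congr rfl fun x hx ↦ ?_
    split_ifs with h
    · refine hχ x ?_ (Finset.mem_filter.mp hx).2
      rintro rfl
      simp at h
    · rfl
  have := dvd_sub (hmod 0) (hmod 1)
  rw [h0, h1, hcard] at this
  convert this using 1
  ring

end

namespace EisensteinInt

open QuadraticAlgebra

theorem omega_pow_three : (omega : EisensteinInt) ^ 3 = 1 := by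
  linear_combination (omega - 1) * omega_mul_omega

theorem orderOf_omega : orderOf (omega : EisensteinInt) = 3 := by
  refine orderOf_eq_prime omega_pow_three fun h ↦ ?_
  simpa using congrArg QuadraticAlgebra.im h

/-- The embedding of the Eisenstein integers into `ℂ` that sends `ω` to `(-1 + √-3) / 2`. -/
noncomputable def toComplex : EisensteinInt →+* ℂ :=
  (lift (R := ℤ) (A := ℂ) ⟨(-1 + Complex.I * Real.sqrt 3) / 2, by
    have h3 : (Real.sqrt 3 : ℂ) ^ 2 = 3 := by
      rw [← Complex.ofReal_pow, Real.sq_sqrt (by norm_num)]; norm_num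
    simp only [neg_smul, one_smul]
    linear_combination (Real.sqrt 3 : ℂ) ^ 2 / 4 * Complex.I_sq - h3 / 4⟩).toRingHom

theorem toComplex_apply (z : EisensteinInt) :
    toComplex z = z.re + z.im * ((-1 + Complex.I * Real.sqrt 3) / 2) := by
  simp [toComplex, lift]

theorem toComplex_injective : Function.Injective toComplex := by
  rw [injective_iff_map_eq_zero]
  intro z hz
  rw [toComplex_apply] at hz
  have hi : z.im = 0 := by simpa using congrArg Complex.im hz
  have hr : z.re = 0 := by simpa [hi] using hz
  ext <;> simpa

theorem star_toComplex (z : EisensteinInt) :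
    starRingEnd ℂ (toComplex z) = toComplex (star z) := by
  have h2 : starRingEnd ℂ 2 = 2 := Complex.conj_ofNat 2
  rw [toComplex_apply, toComplex_apply]
  simp [h2]
  ring

end EisensteinInt

open QuadraticAlgebra EisensteinInt in
/-- A cubic residue character of a finite field with `3 * a + 1` elements, valued in `ℤ[ω]`,
together with a reduction map of `ℤ[ω]` under which it becomes `x ↦ x ^ (2 * a)`. -/
theorem exists_cubicResidueChar {F : Type*} [Field F] [Fintype F] {a : ℕ} (ha : a ≠ 0)
    (hcard : 3 * a + 1 = Fintype.card F) :
    ∃ (χ : MulChar F EisensteinInt) (φ : EisensteinInt →+* F), χ ^ 3 = 1 ∧ χ ≠ 1 ∧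
      (∀ x, φ (χ x) = x ^ (2 * a)) ∧ ∀ x : F, x ^ a = 1 → χ x = 1 := by
  obtain ⟨g, hg⟩ := IsCyclic.exists_monoid_generator (α := Fˣ)
  have hg' (x : Fˣ) : x ∈ Subgroup.zpowers g := mem_powers_iff_mem_zpowers.mp (hg x)
  have hcardU : Fintype.card Fˣ = 3 * a := by rw [Fintype.card_units]; lia
  have hord : orderOf g = 3 * a := by
    rw [orderOf_eq_card_of_forall_mem_zpowers hg', Nat.card_eq_fintype_card, hcardU]
  let w : EisensteinIntˣ := Units.ofPowEqOne omega 3 omega_pow_three (by norm_num)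
  have hw : w ∈ rootsOfUnity (Fintype.card Fˣ) EisensteinInt := by
    rw [mem_rootsOfUnity, hcardU, pow_mul]
    ext1
    simp [w]
  let χ := MulChar.ofRootOfUnity hw hg'
  have hχg : χ g = omega := MulChar.ofRootOfUnity_spec hw hg'
  have hχpow (k : ℕ) : χ ((g ^ k : Fˣ) : F) = omega ^ k := by
    rw [Units.val_pow_eq_pow_val, map_pow, hχg]
  have hv3 : ((g : F) ^ (2 * a)) ^ 3 = 1 := by
    rw [← pow_mul, show 2 * a * 3 = orderOf g * 2 by rw [hord]; ring, pow_mul,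
      ← Units.val_pow_eq_pow_val, pow_orderOf_eq_one]
    simp
  have hv1 : (g : F) ^ (2 * a) - 1 ≠ 0 := by
    intro h
    have h' : g ^ (2 * a) = 1 := by
      ext1
      simpa [sub_eq_zero] using h
    have := Nat.le_of_dvd (by lia) (orderOf_dvd_of_pow_eq_one h')
    lia
  let φ : EisensteinInt →+* F := (lift (R := ℤ) (A := F) ⟨(g : F) ^ (2 * a), by
    simp only [neg_smul, one_smul]
    refine mul_left_cancel₀ hv1 ?_
    linear_combination hv3⟩).toRingHom
  have hφ : φ omega = (g : F) ^ (2 * a) := by simp [φ, lift]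
  refine ⟨χ, φ, ?_, ?_, ?_, ?_⟩
  · rw [MulChar.eq_iff hg', MulChar.pow_apply' _ three_ne_zero, hχg, omega_pow_three]
    simp
  · intro h
    have : (omega : EisensteinInt) = 1 := by rw [← hχg, h]; simp
    simpa using congrArg QuadraticAlgebra.im this
  · intro x
    rcases eq_or_ne x 0 with rfl | hx
    · rw [MulChar.map_zero, map_zero, zero_pow (by lia)]
    · obtain ⟨k, hk⟩ := hg (Units.mk0 x hx)
      have hk' : ((g ^ k : Fˣ) : F) = x := by
        simpa using congrArg Units.val hk
      rw [← hk', hχpow, map_pow, hφ, Units.val_pow_eq_pow_val, pow_right_comm]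
  · intro x hxa
    have hx : x ≠ 0 := by rintro rfl; simp [ha] at hxa
    obtain ⟨k, hk⟩ := hg (Units.mk0 x hx)
    have hk' : ((g ^ k : Fˣ) : F) = x := by
      simpa using congrArg Units.val hk
    have h1 : g ^ (k * a) = 1 := by
      ext1
      rw [pow_mul, Units.val_pow_eq_pow_val, hk', hxa, Units.val_one]
    have h3 : 3 ∣ k := by
      have := orderOf_dvd_of_pow_eq_one h1
      rw [hord] at this
      exact Nat.dvd_of_mul_dvd_mul_right (Nat.pos_of_ne_zero ha) this
    rw [← hk', hχpow]
    exact orderOf_dvd_iff_pow_eq_one.mp (orderOf_omega ▸ h3)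

open EisensteinInt in
/-- The Jacobi sum of a cubic residue character has norm `#F`. -/
theorem norm_jacobiSum_self {F : Type*} [Field F] [Fintype F]
    {χ : MulChar F EisensteinInt} (h3 : χ ^ 3 = 1) (h1 : χ ≠ 1) :
    (jacobiSum χ χ).norm = Fintype.card F := by
  have hχ : χ.ringHomComp toComplex ≠ 1 :=
    (MulChar.ringHomComp_ne_one_iff toComplex_injective).mpr h1
  have hχ2 : χ.ringHomComp toComplex * χ.ringHomComp toComplex ≠ 1 := by
    rw [← MulChar.ringHomComp_mul, MulChar.ringHomComp_ne_one_iff toComplex_injective]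
    intro h
    exact h1 (by simpa [pow_succ, h] using h3)
  have hchar : ringChar ℂ ≠ ringChar F := by
    rw [ringChar.eq_zero]
    exact (CharP.ringChar_ne_zero_of_finite F).symm
  have hJ := jacobiSum_mul_jacobiSum_inv hchar hχ hχ hχ2
  have hstar : (χ.ringHomComp toComplex)⁻¹ =
      (χ.ringHomComp toComplex).ringHomComp (starRingEnd ℂ) :=
    (MulChar.star_eq_inv _).symm
  rw [hstar, jacobiSum_ringHomComp _ _ (starRingEnd ℂ),
    jacobiSum_ringHomComp, star_toComplex, ← map_mul, mul_star_eq_norm, map_intCast] at hJ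
  exact_mod_cast hJ

open EisensteinInt in
theorem exists_gaussSum_eq_toComplex {p s : ℕ} [Fact p.Prime] (hp3 : p % 3 = 1) (hs : s ≠ 0)
    {F : Type*} [Field F] [Fintype F] [Algebra (ZMod p) F]
    (hcard : Fintype.card F = p ^ (3 * s)) {ψ : AddChar F ℂ}
    (hψ : ∀ x, ψ x = ZMod.stdAddChar (Algebra.trace (ZMod p) F x)) :
    ∃ (χ : MulChar F EisensteinInt) (T : EisensteinInt), χ ^ 3 = 1 ∧ χ ≠ 1 ∧
      gaussSum (χ.ringHomComp toComplex) ψ = toComplex T ∧ 3 ∣ T + 1 ∧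
      T ^ 3 = (p : EisensteinInt) ^ (3 * s) * jacobiSum χ χ ∧
      (jacobiSum χ χ).norm = p ^ (3 * s) ∧ ¬ (p : EisensteinInt) ∣ jacobiSum χ χ := by
  have hp : p.Prime := Fact.out
  have hps : p ^ s % 3 = 1 := by rw [Nat.pow_mod, hp3, one_pow]; rfl
  obtain ⟨m, hm⟩ : ∃ m, p ^ s = 3 * m + 1 := ⟨p ^ s / 3, by lia⟩
  have hm0 : m ≠ 0 := by
    rintro rfl
    have := Nat.one_lt_pow hs hp.one_lt
    lia
  let a := 3 * m * (3 * m ^ 2 + 3 * m + 1)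
  have ha : a ≠ 0 := by simp [a, hm0]
  have ha' : 3 * a + 1 = p ^ (3 * s) := by
    rw [mul_comm 3 s, pow_mul, hm]; simp only [a]; ring
  obtain ⟨χ, φ, h3, h1, hφ, hχ⟩ := exists_cubicResidueChar (F := F) ha (by rw [ha', hcard])
  have hχ' : χ.ringHomComp toComplex ≠ 1 :=
    (MulChar.ringHomComp_ne_one_iff toComplex_injective).mpr h1
  have : CharP F p := charP_of_injective_algebraMap (algebraMap (ZMod p) F).injective p
  let σ : F ≃ₐ[ZMod p] F := FiniteField.frobeniusAlgEquivOfAlgebraic (ZMod p) F ^ s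
  have hσ (x : F) : σ x = x ^ p ^ s := by
    have := congrFun (FiniteField.coe_frobeniusAlgEquivOfAlgebraic_iterate (ZMod p) F s) x
    rwa [← AlgEquiv.coe_pow, ZMod.card] at this
  have hσ3 (x : F) : σ (σ (σ x)) = x := by
    rw [hσ, hσ, hσ, ← pow_mul, ← pow_mul, ← pow_add, ← pow_add,
      show s + (s + s) = 3 * s by ring, ← hcard, FiniteField.pow_card]
  have hχ3 (x : F) (hx : x ≠ 0) : χ x ^ 3 = 1 := by
    rw [← MulChar.pow_apply' _ three_ne_zero, h3, MulChar.one_apply hx.isUnit]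
  have hχσ (x : F) : χ (σ x) = χ x := by
    rcases eq_or_ne x 0 with rfl | hx
    · simp
    · rw [hσ, hm, map_pow, pow_succ, pow_mul, hχ3 x hx, one_pow, one_mul]
  have hfix (x : F) (hx : x ≠ 0) (hxσ : σ x = x) : χ x = 1 := by
    refine hχ x ?_
    rw [hσ, hm, pow_succ] at hxσ
    have : x ^ (3 * m) = 1 := mul_right_cancel₀ hx (hxσ.trans (one_mul x).symm)
    rw [show a = 3 * m * (3 * m ^ 2 + 3 * m + 1) from rfl, pow_mul, this, one_pow]
  have hstd : (ZMod.stdAddChar : AddChar (ZMod p) ℂ) ≠ 1 := by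
    have := ZMod.isPrimitive_stdAddChar p one_ne_zero
    simpa using this
  have hψ1 : ψ ≠ 1 := by
    intro h
    refine hstd (DFunLike.ext _ _ fun c ↦ ?_)
    obtain ⟨x, rfl⟩ := Algebra.trace_surjective (ZMod p) F c
    rw [← hψ, h]; rfl
  let T := ∑ x with Algebra.trace (ZMod p) F x = 0, χ x -
    ∑ x with Algebra.trace (ZMod p) F x = 1, χ x
  have hT : gaussSum (χ.ringHomComp toComplex) ψ = toComplex T := by
    rw [gaussSum_trace_eq_sub (χ.ringHomComp toComplex) (fun c hc ↦ ?_) ψ ZMod.stdAddChar hstd hψ]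
    · simp [T, MulChar.ringHomComp_apply]
    · rw [MulChar.ringHomComp_apply, hfix _ (by simpa using hc) (σ.commutes c), map_one]
  refine ⟨χ, T, h3, h1, hT, three_dvd_sum_sub_sum_add_one (by lia) σ hσ3 χ hχσ hfix, ?_, ?_, ?_⟩
  · apply toComplex_injective
    have hord : orderOf (χ.ringHomComp toComplex) = 3 :=
      orderOf_eq_prime (by rw [MulChar.ringHomComp_pow, h3, MulChar.ringHomComp_one]) hχ'
    have := gaussSum_pow_eq_prod_jacobiSum (χ := χ.ringHomComp toComplex) (ψ := ψ)
      (by rw [hord]; norm_num) (AddChar.IsPrimitive.of_ne_one hψ1)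
    rw [hord, MulChar.ringHomComp_apply, MulChar.val_neg_one_eq_one_of_odd_order (by decide) h3,
      hT] at this
    rw [map_pow, this]
    simp [hcard, jacobiSum_ringHomComp]
  · rw [norm_jacobiSum_self h3 h1, hcard]; simp
  · rintro ⟨w, hw⟩
    have hJ : φ (jacobiSum χ χ) = 0 := by
      rw [hw, map_mul, map_natCast, CharP.cast_eq_zero, zero_mul]
    simp only [jacobiSum, map_sum, map_mul, hφ] at hJ
    rw [FiniteField.sum_pow_mul_one_sub_pow ha (by rw [ha', hcard]), neg_eq_zero, mul_eq_zero,
      CharP.cast_eq_zero_iff F p] at hJ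
    exact hp.not_dvd_choose_two_mul_self hp3 _ ha' (hJ.resolve_left (by simp))

/-- For `p ≡ 1 (mod 3)`, `3 ∣ t`, `r = p^t`, there is a cubic character `ρ`
of `GF(r)` with `τ(ρ) = (−1)^{t+1} p^{t/3} π^{t/3}` and `τ(ρ²) = (−1)^{t+1} p^{t/3} π̄^{t/3}`. -/
theorem stmt_10 (p t : ℕ) (hp : p.Prime) (hp3 : p % 3 = 1) (ht : 1 ≤ t) (ht3 : 3 ∣ t)
    (F : Type) [Field F] [Fintype F] [Algebra (ZMod p) F]
    (hcardF : Fintype.card F = p ^ t)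
    (ψ : F → ℂ)
    (hψ : ∀ x : F, ψ x = Complex.exp (2 * Real.pi * Complex.I *
      (ZMod.val (Algebra.trace (ZMod p) F x)) / p))
    (a₀ b₀ : ℤ) (hpab : (p : ℤ) = a₀ ^ 2 - a₀ * b₀ + b₀ ^ 2)
    (ha₀ : a₀ % 3 = 2) (hb₀ : b₀ % 3 = 0) (hb₀pos : 0 < b₀)
    (ω πc : ℂ) (hω : ω = (-1 + Complex.I * Real.sqrt 3) / 2)
    (hπ : πc = (a₀ : ℂ) + (b₀ : ℂ) * ω) :
    ∃ ρ : MulChar F ℂ, orderOf ρ = 3 ∧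
      (∑ x ∈ Finset.univ.filter (fun x : F => x ≠ 0), ρ x * ψ x) =
        (-1 : ℂ) ^ (t + 1) * (p : ℂ) ^ (t / 3) * πc ^ (t / 3) ∧
      (∑ x ∈ Finset.univ.filter (fun x : F => x ≠ 0), (ρ ^ 2) x * ψ x) =
        (-1 : ℂ) ^ (t + 1) * (p : ℂ) ^ (t / 3) * (starRingEnd ℂ πc) ^ (t / 3) := by
  have : Fact p.Prime := ⟨hp⟩
  obtain ⟨s, rfl⟩ := ht3
  have hs : 3 * s / 3 = s := by lia
  rw [hs]
  let Ψ : AddChar F ℂ :=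
    ZMod.stdAddChar.compAddMonoidHom (Algebra.trace (ZMod p) F).toAddMonoidHom
  have hΨ (x : F) : Ψ x = ZMod.stdAddChar (Algebra.trace (ZMod p) F x) := rfl
  have hψΨ : ψ = Ψ := by
    funext x
    rw [hψ, hΨ, ZMod.stdAddChar_apply, ZMod.toCircle_apply]
  have hsum (ρ : MulChar F ℂ) :
      ∑ x ∈ Finset.univ.filter (fun x : F => x ≠ 0), ρ x * ψ x = gaussSum ρ Ψ := by
    rw [gaussSum, hψΨ]
    refine Finset.sum_subset (Finset.subset_univ _) fun x _ hx ↦ ?_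
    have : x = 0 := by simpa using hx
    rw [this, MulChar.map_zero, zero_mul]
  obtain ⟨χ, T, h3, h1, hT, hT3, hTJ, hJn, hpJ⟩ :=
    exists_gaussSum_eq_toComplex hp3 (by lia) hcardF hΨ
  let q : EisensteinInt := ⟨a₀, b₀⟩
  have hq : EisensteinInt.toComplex q = πc := by rw [EisensteinInt.toComplex_apply, hπ, hω]
  have hqn : q.norm = p := by rw [EisensteinInt.norm_eq, hpab]
  have hq3 : 3 ∣ q + 1 := by
    rw [EisensteinInt.three_dvd_iff]
    simp [q, QuadraticAlgebra.re_one, QuadraticAlgebra.im_one]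
    lia
  let ρ := χ.ringHomComp EisensteinInt.toComplex
  have hρ3 : ρ ^ 3 = 1 := by rw [MulChar.ringHomComp_pow, h3, MulChar.ringHomComp_one]
  have hρ1 : ρ ≠ 1 := (MulChar.ringHomComp_ne_one_iff EisensteinInt.toComplex_injective).mpr h1
  have hρ2 : ρ ^ 2 = ρ⁻¹ := eq_inv_of_mul_eq_one_left (by rw [← pow_succ, hρ3])
  have hinv : gaussSum ρ⁻¹ Ψ = starRingEnd ℂ (gaussSum ρ Ψ) := by
    have hneg : ρ⁻¹ (-1) = 1 :=
      MulChar.val_neg_one_eq_one_of_odd_order (n := 3) (by decide) (by rw [inv_pow, hρ3, inv_one])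
    rw [starRingEnd_apply, star_gaussSum_eq, ← mul_gaussSum_inv_eq_gaussSum, hneg, one_mul]
  simp only [hsum]
  rcases EisensteinInt.eq_of_norm_eq_of_pow_three_eq_mul hp hp3 hqn hq3 hT3 hTJ hJn hpJ with h | h
  · have hg : gaussSum ρ Ψ = (-1) ^ (3 * s + 1) * (p : ℂ) ^ s * πc ^ s := by
      rw [hT, h, ← hq]
      simp
    refine ⟨ρ, orderOf_eq_prime hρ3 hρ1, hg, ?_⟩
    rw [hρ2, hinv, hg]
    simp
  · have hg : gaussSum ρ Ψ =
        (-1) ^ (3 * s + 1) * (p : ℂ) ^ s * (starRingEnd ℂ πc) ^ s := by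
      rw [hT, h, ← hq, EisensteinInt.star_toComplex]
      simp
    refine ⟨ρ⁻¹, orderOf_eq_prime (by rw [inv_pow, hρ3, inv_one]) (inv_ne_one.mpr hρ1), ?_, ?_⟩
    · rw [hinv, hg]
      simp
    · rw [inv_pow, hρ2, inv_inv, hg]
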